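/- arXiv:2204.14058 — 14 statements merged into one kernel-verified Lean document; each statement's English description precedes it below -/
import Mathlib

section
/- Let ρ₁ > 0, ρ₂ > 0, m₀ > 0, u₂ < u₀ < u₁ and ρ₁ ≠ ρ₂ be real constants. Set f(t) = ρ₁ρ₂(u₁−u₂)²t² + 2m₀[ρ₁(u₁−u₀) − ρ₂(u₂−u₀)]t + m₀² and x₁(t) = [(ρ₁u₁−ρ₂u₂)t + m₀ − √(f(t))]/(ρ₁−ρ₂) for t ≥ 0. Then x₁ is twice differentiable on [0, ∞), x₁(0) = 0, x₁'(0) = u₀, the denominator D(t) := (ρ₁−ρ₂)x₁(t) − (ρ₁u₁−ρ₂u₂)t − m₀ satisfies D(t) = −√(f(t)) < 0 for all t ≥ 0, and x₁ solves the free piston ODE: x₁''(t)·D(t) + [(ρ₁−ρ₂)x₁'(t) − 2(ρ₁u₁−ρ₂u₂)]·x₁'(t) + (ρ₁u₁² − ρ₂u₂²) = 0 for all t ≥ 0. -/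
/-- Derivative of the square root of a quadratic polynomial where the latter is positive. -/
theorem hasDerivAt_sqrt_quadratic {A B C t : ℝ} (h : 0 < A * t ^ 2 + 2 * B * t + C) :
    HasDerivAt (fun τ => Real.sqrt (A * τ ^ 2 + 2 * B * τ + C))
      ((A * t + B) / Real.sqrt (A * t ^ 2 + 2 * B * t + C)) t := by
  have hq : HasDerivAt (fun τ : ℝ => A * τ ^ 2 + 2 * B * τ + C) (2 * (A * t + B)) t := by
    refine HasDerivAt.congr_deriv (((((hasDerivAt_id t).pow 2).const_mul A).add
      ((hasDerivAt_id t).const_mul (2 * B))).add_const C) ?_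
    simp
    ring
  refine (hq.sqrt h.ne').congr_deriv ?_
  rw [mul_div_mul_left _ _ two_ne_zero]

/-- Case 1 (`ρ₁ ≠ ρ₂`) of the free piston problem: the explicit trajectory
`x₁(t) = [(ρ₁u₁−ρ₂u₂)t + m₀ − √(f t)]/(ρ₁−ρ₂)` is twice differentiable on `[0,∞)`,
satisfies the initial conditions, the denominator `D(t)` equals `−√(f t) < 0`, and
`x₁` solves the free piston ODE. -/
theorem piston_trajectory_solves_ODE (ρ₁ ρ₂ m₀ u₀ u₁ u₂ : ℝ)
    (hρ₁ : 0 < ρ₁) (hρ₂ : 0 < ρ₂) (hm₀ : 0 < m₀)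
    (h₂₀ : u₂ < u₀) (h₀₁ : u₀ < u₁) (hne : ρ₁ ≠ ρ₂)
    (f x₁ D : ℝ → ℝ)
    (hf : ∀ t : ℝ, f t =
      ρ₁ * ρ₂ * (u₁ - u₂) ^ 2 * t ^ 2
        + 2 * m₀ * (ρ₁ * (u₁ - u₀) - ρ₂ * (u₂ - u₀)) * t + m₀ ^ 2)
    (hx : ∀ t : ℝ, x₁ t =
      ((ρ₁ * u₁ - ρ₂ * u₂) * t + m₀ - Real.sqrt (f t)) / (ρ₁ - ρ₂))
    (hD : ∀ t : ℝ, D t = (ρ₁ - ρ₂) * x₁ t - (ρ₁ * u₁ - ρ₂ * u₂) * t - m₀) :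
    (∀ t : ℝ, 0 ≤ t → DifferentiableAt ℝ x₁ t ∧ DifferentiableAt ℝ (deriv x₁) t) ∧
    x₁ 0 = 0 ∧ deriv x₁ 0 = u₀ ∧
    (∀ t : ℝ, 0 ≤ t → D t = -Real.sqrt (f t) ∧ D t < 0) ∧
    (∀ t : ℝ, 0 ≤ t →
      deriv (deriv x₁) t * D t
        + ((ρ₁ - ρ₂) * deriv x₁ t - 2 * (ρ₁ * u₁ - ρ₂ * u₂)) * deriv x₁ t
        + (ρ₁ * u₁ ^ 2 - ρ₂ * u₂ ^ 2) = 0) := by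
  set A := ρ₁ * ρ₂ * (u₁ - u₂) ^ 2 with hA
  set B := m₀ * (ρ₁ * (u₁ - u₀) - ρ₂ * (u₂ - u₀)) with hB
  set b := ρ₁ * u₁ - ρ₂ * u₂ with hb
  have ha : ρ₁ - ρ₂ ≠ 0 := sub_ne_zero.mpr hne
  have hA0 : 0 ≤ A := by positivity
  have hB0 : 0 ≤ B := by
    have h1 := mul_pos hρ₁ (sub_pos.mpr h₀₁)
    have h2 := mul_pos hρ₂ (sub_pos.mpr h₂₀)
    exact mul_nonneg hm₀.le (by linarith)
  have hf' : f = fun t => A * t ^ 2 + 2 * B * t + m₀ ^ 2 := by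
    funext t
    rw [hf, hB]
    ring
  have hfpos : ∀ t : ℝ, 0 ≤ t → 0 < f t := by
    intro t ht
    rw [hf']
    positivity
  have hs : ∀ t : ℝ, 0 < f t →
      HasDerivAt (fun τ => Real.sqrt (f τ)) ((A * t + B) / Real.sqrt (f t)) t := by
    intro t ht
    rw [hf'] at ht ⊢
    exact hasDerivAt_sqrt_quadratic ht
  have hx1 : ∀ t : ℝ, 0 < f t →
      HasDerivAt x₁ ((b - (A * t + B) / Real.sqrt (f t)) / (ρ₁ - ρ₂)) t := by
    intro t ht
    rw [funext hx]
    have hlin : HasDerivAt (fun τ : ℝ => b * τ + m₀) b t := by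
      simpa using ((hasDerivAt_id t).const_mul b).add_const m₀
    exact (hlin.sub (hs t ht)).div_const _
  have hfc : Continuous f := by
    rw [hf']
    fun_prop
  have hx2 : ∀ t : ℝ, 0 < f t → HasDerivAt (deriv x₁)
      (-((A * Real.sqrt (f t) - (A * t + B) * ((A * t + B) / Real.sqrt (f t)))
        / Real.sqrt (f t) ^ 2) / (ρ₁ - ρ₂)) t := by
    intro t ht
    have hlin : HasDerivAt (fun τ : ℝ => A * τ + B) A t := by
      simpa using ((hasDerivAt_id t).const_mul A).add_const B
    refine HasDerivAt.congr_of_eventuallyEq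
      (((hlin.div (hs t ht) (Real.sqrt_pos.mpr ht).ne').const_sub b).div_const _) ?_
    filter_upwards [hfc.continuousAt.eventually (lt_mem_nhds ht)] with τ hτ
    exact (hx1 τ hτ).deriv
  have hDs : ∀ t : ℝ, D t = -Real.sqrt (f t) := by
    intro t
    rw [hD, hx, mul_div_cancel₀ _ ha]
    ring
  have hsqrt0 : Real.sqrt (f 0) = m₀ := by
    rw [hf']
    simp [Real.sqrt_sq hm₀.le]
  refine ⟨fun t ht => ⟨(hx1 t (hfpos t ht)).differentiableAt,
    (hx2 t (hfpos t ht)).differentiableAt⟩, ?_, ?_, fun t ht => ⟨hDs t, ?_⟩, fun t ht => ?_⟩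
  · rw [hx, hsqrt0]
    simp
  · rw [(hx1 0 (hfpos 0 le_rfl)).deriv, hsqrt0, hB, hb]
    field_simp
    ring
  · rw [hDs]
    exact neg_lt_zero.mpr (Real.sqrt_pos.mpr (hfpos t ht))
  · have hpos := hfpos t ht
    rw [(hx2 t hpos).deriv, (hx1 t hpos).deriv, hDs]
    have hs0 : Real.sqrt (f t) ≠ 0 := (Real.sqrt_pos.mpr hpos).ne'
    generalize Real.sqrt (f t) = s at hs0
    field_simp
    rw [hA, hb]
    ring
end

section
/- Let ρ₁ > 0, ρ₂ > 0, m₀ > 0, u₂ < u₀ < u₁ and ρ₁ ≠ ρ₂ be real constants, and let x₁(t) = [(ρ₁u₁−ρ₂u₂)t + m₀ − √(f(t))]/(ρ₁−ρ₂) with f(t) = ρ₁ρ₂(u₁−u₂)²t² + 2m₀[ρ₁(u₁−u₀) − ρ₂(u₂−u₀)]t + m₀². Then x₁ satisfies the momentum conservation relation x₁'(t)·[ρ₁u₁t − ρ₁x₁(t) + m₀ − ρ₂u₂t + ρ₂x₁(t)] = ρ₁u₁²t − ρ₁u₁x₁(t) − ρ₂u₂²t + ρ₂u₂x₁(t) +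 m₀u₀ for every t ≥ 0. -/
/-- Case 1 (`ρ₁ ≠ ρ₂`): the explicit trajectory `x₁` satisfies the momentum
conservation relation for all `t ≥ 0`. -/
theorem piston_momentum_conservation (ρ₁ ρ₂ m₀ u₀ u₁ u₂ : ℝ)
    (hρ₁ : 0 < ρ₁) (hρ₂ : 0 < ρ₂) (hm₀ : 0 < m₀)
    (h₂₀ : u₂ < u₀) (h₀₁ : u₀ < u₁) (hne : ρ₁ ≠ ρ₂)
    (f x₁ : ℝ → ℝ)
    (hf : ∀ t : ℝ, f t =
      ρ₁ * ρ₂ * (u₁ - u₂) ^ 2 * t ^ 2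
        + 2 * m₀ * (ρ₁ * (u₁ - u₀) - ρ₂ * (u₂ - u₀)) * t + m₀ ^ 2)
    (hx : ∀ t : ℝ, x₁ t =
      ((ρ₁ * u₁ - ρ₂ * u₂) * t + m₀ - Real.sqrt (f t)) / (ρ₁ - ρ₂)) :
    ∀ t : ℝ, 0 ≤ t →
      deriv x₁ t *
        (ρ₁ * u₁ * t - ρ₁ * x₁ t + m₀ - ρ₂ * u₂ * t + ρ₂ * x₁ t) =
      ρ₁ * u₁ ^ 2 * t - ρ₁ * u₁ * x₁ t - ρ₂ * u₂ ^ 2 * t + ρ₂ * u₂ * x₁ t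
        + m₀ * u₀ := by
  intro t ht
  have hd : ρ₁ - ρ₂ ≠ 0 := sub_ne_zero.mpr hne
  have hft : 0 < f t := by
    have h₁ : 0 < u₁ - u₀ := sub_pos.mpr h₀₁
    have h₂ : 0 < u₀ - u₂ := sub_pos.mpr h₂₀
    have hb : 0 ≤ ρ₁ * (u₁ - u₀) - ρ₂ * (u₂ - u₀) := by
      have : 0 ≤ ρ₁ * (u₁ - u₀) + ρ₂ * (u₀ - u₂) := by positivity
      linarith
    rw [hf]
    positivity
  have hf' : HasDerivAt f (ρ₁ * ρ₂ * (u₁ - u₂) ^ 2 * (2 * t)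
      + 2 * m₀ * (ρ₁ * (u₁ - u₀) - ρ₂ * (u₂ - u₀))) t := by
    rw [funext hf]
    have h := ((((hasDerivAt_id t).pow 2).const_mul (ρ₁ * ρ₂ * (u₁ - u₂) ^ 2)).add
      ((hasDerivAt_id t).const_mul
        (2 * m₀ * (ρ₁ * (u₁ - u₀) - ρ₂ * (u₂ - u₀))))).add_const (m₀ ^ 2)
    exact h.congr_deriv (by simp)
  have hx' : HasDerivAt x₁ (((ρ₁ * u₁ - ρ₂ * u₂) -
      (ρ₁ * ρ₂ * (u₁ - u₂) ^ 2 * (2 * t)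
        + 2 * m₀ * (ρ₁ * (u₁ - u₀) - ρ₂ * (u₂ - u₀))) / (2 * Real.sqrt (f t)))
      / (ρ₁ - ρ₂)) t := by
    rw [funext hx]
    have h := (((((hasDerivAt_id t).const_mul (ρ₁ * u₁ - ρ₂ * u₂)).add_const m₀).sub
      (hf'.sqrt hft.ne')).div_const (ρ₁ - ρ₂))
    exact h.congr_deriv (by simp)
  have hs : Real.sqrt (f t) ≠ 0 := (Real.sqrt_pos.mpr hft).ne'
  rw [hx'.deriv, hx t]
  field_simp
  ring
end

section
/- Let ρ₁ > 0, ρ₂ > 0, m₀ > 0, u₂ < u₀ < u₁ and ρ₁ ≠ ρ₂ be real constants, and let x₁(t) = [(ρ₁u₁−ρ₂u₂)t + m₀ − √(f(t))]/(ρ₁−ρ₂) with f(t) = ρ₁ρ₂(u₁−u₂)²t² + 2m₀[ρ₁(u₁−u₀) − ρ₂(u₂−u₀)]t + m₀². Then the over-compressing entropy condition u₂ < x₁'(t) < u₁ holds for every t ≥ 0. -/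
/-- Case 1 (`ρ₁ ≠ ρ₂`): the over-compressing entropy condition
`u₂ < x₁'(t) < u₁` holds for all `t ≥ 0` along the explicit trajectory. -/
theorem piston_entropy_condition (ρ₁ ρ₂ m₀ u₀ u₁ u₂ : ℝ)
    (hρ₁ : 0 < ρ₁) (hρ₂ : 0 < ρ₂) (hm₀ : 0 < m₀)
    (h₂₀ : u₂ < u₀) (h₀₁ : u₀ < u₁) (hne : ρ₁ ≠ ρ₂)
    (f x₁ : ℝ → ℝ)
    (hf : ∀ t : ℝ, f t =
      ρ₁ * ρ₂ * (u₁ - u₂) ^ 2 * t ^ 2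
        + 2 * m₀ * (ρ₁ * (u₁ - u₀) - ρ₂ * (u₂ - u₀)) * t + m₀ ^ 2)
    (hx : ∀ t : ℝ, x₁ t =
      ((ρ₁ * u₁ - ρ₂ * u₂) * t + m₀ - Real.sqrt (f t)) / (ρ₁ - ρ₂)) :
    ∀ t : ℝ, 0 ≤ t → u₂ < deriv x₁ t ∧ deriv x₁ t < u₁ := by
  intro t ht
  obtain ⟨a, ha⟩ : ∃ a, a = u₁ - u₀ := ⟨_, rfl⟩
  obtain ⟨b, hb⟩ : ∃ b, b = u₀ - u₂ := ⟨_, rfl⟩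
  have ha₀ : 0 < a := by linarith
  have hb₀ : 0 < b := by linarith
  obtain rfl : u₁ = u₂ + a + b := by linarith
  obtain rfl : u₀ = u₂ + b := by linarith
  have hd : ρ₁ - ρ₂ ≠ 0 := sub_ne_zero.mpr hne
  have hft : f t = ρ₁ * ρ₂ * (a + b) ^ 2 * t ^ 2 + 2 * m₀ * (ρ₁ * a + ρ₂ * b) * t + m₀ ^ 2 := by
    rw [hf]; ring
  have hpos : 0 < f t := by rw [hft]; positivity
  have hs : 0 < √(f t) := Real.sqrt_pos.mpr hpos
  have hsq : √(f t) ^ 2 = f t := Real.sq_sqrt hpos.le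
  obtain ⟨g, hg⟩ : ∃ g, g = ρ₁ * ρ₂ * (a + b) ^ 2 * t + m₀ * (ρ₁ * a + ρ₂ * b) := ⟨_, rfl⟩
  have hg₀ : 0 < g := by rw [hg]; positivity
  have hf' : HasDerivAt f (2 * g) t := by
    rw [funext hf]
    refine ((((hasDerivAt_pow 2 t).const_mul _).add
      ((hasDerivAt_id t).const_mul _)).add_const _).congr_deriv ?_
    rw [hg]; push_cast; ring
  have hx' : HasDerivAt x₁
      ((ρ₁ * (u₂ + a + b) - ρ₂ * u₂ - g / √(f t)) / (ρ₁ - ρ₂)) t := by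
    rw [funext hx]
    refine (((((hasDerivAt_id t).const_mul _).add_const _).sub
      (hf'.sqrt hpos.ne')).div_const _).congr_deriv ?_
    field_simp
  rw [hx'.deriv]
  generalize √(f t) = s at hs hsq
  rw [hft] at hsq
  have hlower : (ρ₁ * (u₂ + a + b) - ρ₂ * u₂ - g / s) / (ρ₁ - ρ₂) - u₂ =
      (ρ₁ ^ 2 * ρ₂ * (a + b) ^ 4 * t ^ 2 + 2 * m₀ * (ρ₁ * a + ρ₂ * b) * ρ₁ * (a + b) ^ 2 * t
        + m₀ ^ 2 * b * (ρ₁ * (a + b) + (ρ₁ * a + ρ₂ * b))) / (s * (ρ₁ * (a + b) * s + g)) := by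
    have : ρ₁ * (a + b) * s + g ≠ 0 := by positivity
    field_simp
    rw [hg]
    linear_combination ρ₁ ^ 2 * (a + b) ^ 2 * hsq
  have hupper : u₂ + a + b - (ρ₁ * (u₂ + a + b) - ρ₂ * u₂ - g / s) / (ρ₁ - ρ₂) =
      (ρ₁ * ρ₂ ^ 2 * (a + b) ^ 4 * t ^ 2 + 2 * m₀ * (ρ₁ * a + ρ₂ * b) * ρ₂ * (a + b) ^ 2 * t
        + m₀ ^ 2 * a * (ρ₂ * (a + b) + (ρ₁ * a + ρ₂ * b))) / (s * (ρ₂ * (a + b) * s + g)) := by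
    have : ρ₂ * (a + b) * s + g ≠ 0 := by positivity
    field_simp
    rw [hg]
    linear_combination -ρ₂ ^ 2 * (a + b) ^ 2 * hsq
  constructor
  · rw [← sub_pos, hlower]; positivity
  · rw [← sub_pos, hupper]; positivity
end

section
/- Let ρ₁ > 0, m₀ > 0 and u₂ < u₀ < u₁ be real constants. Define x₁(t) = (u₁+u₂)t/2 + m₀²(u₁+u₂−2u₀)/(2ρ₁(u₁−u₂)[ρ₁(u₁−u₂)t + m₀]) − m₀(u₁+u₂−2u₀)/(2ρ₁(u₁−u₂)) for t ≥ 0. Then x₁ is twice differentiable on [0, ∞), x₁(0) = 0, x₁'(0) = u₀, and x₁ solves the equal-density free piston ODE: x₁''(t)·[−ρ₁(u₁−u₂)t − m₀] − 2ρ₁(u₁−u₂)·x₁'(t) + ρ₁(u₁² − u₂²) = 0 for all t ≥ 0. -/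
/-- Derivative of `t ↦ b t + k / (a t + m) ^ n + c` away from the pole `a t + m = 0`. -/
theorem hasDerivAt_linear_add_div_pow (a b c k m : ℝ) (n : ℕ) {t : ℝ} (ht : a * t + m ≠ 0) :
    HasDerivAt (fun s => b * s + k / (a * s + m) ^ n + c)
      (b - n * a * k / (a * t + m) ^ (n + 1)) t := by
  have hlin : HasDerivAt (fun s => a * s + m) a t := by
    simpa using ((hasDerivAt_id t).const_mul a).add_const m
  have hb : HasDerivAt (fun s => b * s) b t := by
    simpa using (hasDerivAt_id t).const_mul b
  have hdiv := (hasDerivAt_const t k).div (hlin.pow n) (pow_ne_zero n ht)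
  refine ((hb.add hdiv).add_const c).congr_deriv ?_
  rcases n with _ | n
  · simp
  · simp only [Pi.pow_apply, Nat.add_sub_cancel]
    field_simp
    ring

/-- Case 1 with equal densities (`ρ₁ = ρ₂`): the explicit trajectory
`x₁(t) = (u₁+u₂)t/2 + m₀²(u₁+u₂−2u₀)/(2ρ₁(u₁−u₂)[ρ₁(u₁−u₂)t + m₀])
  − m₀(u₁+u₂−2u₀)/(2ρ₁(u₁−u₂))`
is twice differentiable on `[0,∞)`, satisfies the initial conditions, and solves
the equal-density free piston ODE. -/
theorem piston_equal_density_ODE (ρ₁ m₀ u₀ u₁ u₂ : ℝ)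
    (hρ₁ : 0 < ρ₁) (hm₀ : 0 < m₀)
    (h₂₀ : u₂ < u₀) (h₀₁ : u₀ < u₁)
    (x₁ : ℝ → ℝ)
    (hx : ∀ t : ℝ, x₁ t =
      (u₁ + u₂) * t / 2
        + m₀ ^ 2 * (u₁ + u₂ - 2 * u₀) /
            (2 * ρ₁ * (u₁ - u₂) * (ρ₁ * (u₁ - u₂) * t + m₀))
        - m₀ * (u₁ + u₂ - 2 * u₀) / (2 * ρ₁ * (u₁ - u₂))) :
    (∀ t : ℝ, 0 ≤ t → DifferentiableAt ℝ x₁ t ∧ DifferentiableAt ℝ (deriv x₁) t) ∧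
    x₁ 0 = 0 ∧ deriv x₁ 0 = u₀ ∧
    (∀ t : ℝ, 0 ≤ t →
      deriv (deriv x₁) t * (-(ρ₁ * (u₁ - u₂)) * t - m₀)
        - 2 * ρ₁ * (u₁ - u₂) * deriv x₁ t
        + ρ₁ * (u₁ ^ 2 - u₂ ^ 2) = 0) := by
  have hu : 0 < u₁ - u₂ := by linarith
  have hane : ρ₁ * (u₁ - u₂) ≠ 0 := (mul_pos hρ₁ hu).ne'
  set a := ρ₁ * (u₁ - u₂) with ha
  set k := m₀ ^ 2 * (u₁ + u₂ - 2 * u₀) / (2 * a) with hk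
  have hx_eq : x₁ = fun t => (u₁ + u₂) / 2 * t + k / (a * t + m₀) ^ 1
      + -(m₀ * (u₁ + u₂ - 2 * u₀) / (2 * a)) := by
    funext t
    rw [hx t, hk, mul_assoc 2 ρ₁, ← ha, pow_one, div_div]
    ring
  have hderiv : ∀ t, a * t + m₀ ≠ 0 →
      HasDerivAt x₁ ((u₁ + u₂) / 2 - a * k / (a * t + m₀) ^ 2) t := by
    intro t ht
    rw [hx_eq]
    simpa using hasDerivAt_linear_add_div_pow a ((u₁ + u₂) / 2)
      (-(m₀ * (u₁ + u₂ - 2 * u₀) / (2 * a))) k m₀ 1 ht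
  have hderiv2 : ∀ t, a * t + m₀ ≠ 0 →
      HasDerivAt (deriv x₁) (2 * a * (a * k) / (a * t + m₀) ^ 3) t := by
    intro t ht
    have hev : ∀ᶠ s in nhds t, a * s + m₀ ≠ 0 :=
      (by fun_prop : Continuous fun s => a * s + m₀).continuousAt.eventually_ne ht
    refine ((hasDerivAt_linear_add_div_pow a 0 ((u₁ + u₂) / 2) (-(a * k)) m₀ 2 ht).congr_deriv
      ?_).congr_of_eventuallyEq ?_
    · push_cast
      ring
    · filter_upwards [hev] with s hs
      rw [(hderiv s hs).deriv]
      ring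
  have hne : ∀ t, 0 ≤ t → a * t + m₀ ≠ 0 := fun t ht =>
    (add_pos_of_nonneg_of_pos (mul_nonneg (mul_pos hρ₁ hu).le ht) hm₀).ne'
  refine ⟨fun t ht => ⟨(hderiv t (hne t ht)).differentiableAt,
    (hderiv2 t (hne t ht)).differentiableAt⟩, ?_, ?_, fun t ht => ?_⟩
  · simp only [hx_eq, hk, mul_zero, zero_add]
    field_simp
    ring
  · rw [(hderiv 0 (hne 0 le_rfl)).deriv, hk, mul_zero, zero_add]
    field_simp
    ring
  · have hD := hne t ht
    have hode : ρ₁ * (u₁ ^ 2 - u₂ ^ 2) = a * (u₁ + u₂) := by rw [ha]; ring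
    rw [(hderiv t hD).deriv, (hderiv2 t hD).deriv, hode, mul_assoc 2 ρ₁, ← ha,
      show -a * t - m₀ = -(a * t + m₀) by ring]
    field_simp
    ring
end

section
/- Let ρ₁ > 0, m₀ > 0 and u₂ < u₀ < u₁ be real constants, and let x₁(t) = (u₁+u₂)t/2 + m₀²(u₁+u₂−2u₀)/(2ρ₁(u₁−u₂)[ρ₁(u₁−u₂)t + m₀]) − m₀(u₁+u₂−2u₀)/(2ρ₁(u₁−u₂)). Then for every t ≥ 0 one has x₁'(t) = (u₁+u₂)/2 − m₀²(u₁+u₂−2u₀)/(2[ρ₁(u₁−u₂)t + m₀]²), the over-compressing entropy condition u₂ < x₁'(t) < u₁ holds for every t ≥ 0, and lim_{t→∞} x₁'(t) = (u₁+u₂)/2. -/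
/-- Case 1 with equal densities: explicit formula for the piston's velocity,
the over-compressing entropy condition `u₂ < x₁'(t) < u₁`, and the limiting
velocity `(u₁+u₂)/2`. -/
theorem piston_equal_density_velocity (ρ₁ m₀ u₀ u₁ u₂ : ℝ)
    (hρ₁ : 0 < ρ₁) (hm₀ : 0 < m₀)
    (h₂₀ : u₂ < u₀) (h₀₁ : u₀ < u₁)
    (x₁ : ℝ → ℝ)
    (hx : ∀ t : ℝ, x₁ t =
      (u₁ + u₂) * t / 2
        + m₀ ^ 2 * (u₁ + u₂ - 2 * u₀) /
            (2 * ρ₁ * (u₁ - u₂) * (ρ₁ * (u₁ - u₂) * t + m₀))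
        - m₀ * (u₁ + u₂ - 2 * u₀) / (2 * ρ₁ * (u₁ - u₂))) :
    (∀ t : ℝ, 0 ≤ t →
      deriv x₁ t = (u₁ + u₂) / 2
        - m₀ ^ 2 * (u₁ + u₂ - 2 * u₀) / (2 * (ρ₁ * (u₁ - u₂) * t + m₀) ^ 2)) ∧
    (∀ t : ℝ, 0 ≤ t → u₂ < deriv x₁ t ∧ deriv x₁ t < u₁) ∧
    Filter.Tendsto (deriv x₁) Filter.atTop (nhds ((u₁ + u₂) / 2)) := by
  have hd : 0 < u₁ - u₂ := by linarith
  have hk : 0 < ρ₁ * (u₁ - u₂) := mul_pos hρ₁ hd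
  have hD : ∀ t : ℝ, 0 ≤ t → m₀ ≤ ρ₁ * (u₁ - u₂) * t + m₀ := fun t ht => by
    have := mul_nonneg hk.le ht
    linarith
  have hderiv : ∀ t : ℝ, 0 ≤ t →
      deriv x₁ t = (u₁ + u₂) / 2
        - m₀ ^ 2 * (u₁ + u₂ - 2 * u₀) / (2 * (ρ₁ * (u₁ - u₂) * t + m₀) ^ 2) := by
    intro t ht
    rw [funext hx]
    have hDt : ρ₁ * (u₁ - u₂) * t + m₀ ≠ 0 := (hm₀.trans_le (hD t ht)).ne'
    have hlin : HasDerivAt (fun t : ℝ => ρ₁ * (u₁ - u₂) * t + m₀) (ρ₁ * (u₁ - u₂)) t := by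
      simpa using ((hasDerivAt_id t).const_mul (ρ₁ * (u₁ - u₂))).add_const m₀
    have hden := hlin.const_mul (2 * ρ₁ * (u₁ - u₂))
    have hfrac := (hasDerivAt_const t (m₀ ^ 2 * (u₁ + u₂ - 2 * u₀))).fun_div hden
      (mul_ne_zero (by positivity) hDt)
    have hmean := ((hasDerivAt_id' t).const_mul (u₁ + u₂)).div_const 2
    refine ((hmean.fun_add hfrac).sub_const _).deriv.trans ?_
    field_simp
    ring
  refine ⟨hderiv, fun t ht => ?_, ?_⟩
  · have hDt := hD t ht
    have hDpos := hm₀.trans_le hDt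
    have hs_pos : 0 < m₀ ^ 2 / (ρ₁ * (u₁ - u₂) * t + m₀) ^ 2 := by positivity
    have hs_le : m₀ ^ 2 / (ρ₁ * (u₁ - u₂) * t + m₀) ^ 2 ≤ 1 :=
      div_le_one_of_le₀ (by gcongr) (by positivity)
    have hrw : m₀ ^ 2 * (u₁ + u₂ - 2 * u₀) / (2 * (ρ₁ * (u₁ - u₂) * t + m₀) ^ 2)
        = m₀ ^ 2 / (ρ₁ * (u₁ - u₂) * t + m₀) ^ 2 * (u₁ + u₂ - 2 * u₀) / 2 := by
      field_simp
    rw [hderiv t ht, hrw]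
    generalize m₀ ^ 2 / (ρ₁ * (u₁ - u₂) * t + m₀) ^ 2 = s at hs_pos hs_le
    have hleft := mul_pos hs_pos (sub_pos.2 h₂₀)
    have hright := mul_pos hs_pos (sub_pos.2 h₀₁)
    have hgap := mul_nonneg (sub_nonneg.2 hs_le) hd.le
    constructor <;> nlinarith
  · have hlin : Filter.Tendsto (fun t : ℝ => ρ₁ * (u₁ - u₂) * t + m₀)
        Filter.atTop Filter.atTop :=
      Filter.tendsto_atTop_add_const_right _ _ (Filter.tendsto_id.const_mul_atTop hk)
    have hden := ((Filter.tendsto_pow_atTop two_ne_zero).comp hlin).const_mul_atTop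
      (two_pos : (0 : ℝ) < 2)
    have hlim := (hden.const_div_atTop (m₀ ^ 2 * (u₁ + u₂ - 2 * u₀))).const_sub ((u₁ + u₂) / 2)
    rw [sub_zero] at hlim
    refine hlim.congr' ?_
    filter_upwards [Filter.eventually_ge_atTop 0] with t ht
    exact (hderiv t ht).symm
end

section
/- Let ρ₁ > 0, m₀ > 0 and u₀ < u₁ be real constants. Set g(t) = 2m₀ρ₁(u₁−u₀)t + m₀² and x₁(t) = u₁t + m₀/ρ₁ − √(g(t))/ρ₁ for t ≥ 0. Then x₁ is twice differentiable on [0, ∞), x₁(0) = 0, x₁'(0) = u₀, ρ₁x₁(t) − ρ₁u₁t − m₀ = −√(g(t)) < 0 for all t ≥ 0, and x₁ solves the one-sided free piston ODE: x₁''(t)·(ρ₁x₁(t) − ρ₁u₁t − m₀) + x₁'(t)·(ρ₁x₁'(t) − 2ρ₁u₁) + ρ₁u₁² = 0 for all t ≥ 0. -/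
/-- The first derivative of `u t + b - √(2 c r t + d) / r` where the radicand is positive. -/
theorem hasDerivAt_sub_sqrt_affine_div {r : ℝ} (hr : r ≠ 0) (u b c d : ℝ) {t : ℝ}
    (ht : 0 < 2 * c * r * t + d) :
    HasDerivAt (fun s => u * s + b - √(2 * c * r * s + d) / r)
      (u - c / √(2 * c * r * t + d)) t := by
  have hlin : HasDerivAt (fun s => 2 * c * r * s + d) (2 * c * r) t := by
    simpa using ((hasDerivAt_id t).const_mul (2 * c * r)).add_const d
  have haff : HasDerivAt (fun s => u * s + b) u t := by
    simpa using ((hasDerivAt_id t).const_mul u).add_const b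
  have hs : √(2 * c * r * t + d) ≠ 0 := (Real.sqrt_pos.2 ht).ne'
  refine (haff.sub ((hlin.sqrt ht.ne').div_const r)).congr_deriv ?_
  field_simp

/-- The derivative of `u - c / √(2 c r t + d)` where the radicand is positive. -/
theorem hasDerivAt_sub_div_sqrt_affine (r u c d : ℝ) {t : ℝ} (ht : 0 < 2 * c * r * t + d) :
    HasDerivAt (fun s => u - c / √(2 * c * r * s + d))
      (c ^ 2 * r / √(2 * c * r * t + d) ^ 3) t := by
  have hlin : HasDerivAt (fun s => 2 * c * r * s + d) (2 * c * r) t := by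
    simpa using ((hasDerivAt_id t).const_mul (2 * c * r)).add_const d
  have hs : √(2 * c * r * t + d) ≠ 0 := (Real.sqrt_pos.2 ht).ne'
  refine (((hasDerivAt_const t c).div (hlin.sqrt ht.ne') hs).const_sub u).congr_deriv ?_
  field_simp
  ring

/-- Case 2 (vacuum on the right): the explicit trajectory
`x₁(t) = u₁t + m₀/ρ₁ − √(g t)/ρ₁` with `g(t) = 2m₀ρ₁(u₁−u₀)t + m₀²` is twice
differentiable on `[0,∞)`, satisfies the initial conditions, has
`ρ₁x₁(t) − ρ₁u₁t − m₀ = −√(g t) < 0`, and solves the one-sided free piston ODE. -/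
theorem piston_one_sided_ODE (ρ₁ m₀ u₀ u₁ : ℝ)
    (hρ₁ : 0 < ρ₁) (hm₀ : 0 < m₀) (h₀₁ : u₀ < u₁)
    (g x₁ : ℝ → ℝ)
    (hg : ∀ t : ℝ, g t = 2 * m₀ * ρ₁ * (u₁ - u₀) * t + m₀ ^ 2)
    (hx : ∀ t : ℝ, x₁ t = u₁ * t + m₀ / ρ₁ - Real.sqrt (g t) / ρ₁) :
    (∀ t : ℝ, 0 ≤ t → DifferentiableAt ℝ x₁ t ∧ DifferentiableAt ℝ (deriv x₁) t) ∧
    x₁ 0 = 0 ∧ deriv x₁ 0 = u₀ ∧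
    (∀ t : ℝ, 0 ≤ t →
      ρ₁ * x₁ t - ρ₁ * u₁ * t - m₀ = -Real.sqrt (g t) ∧
      ρ₁ * x₁ t - ρ₁ * u₁ * t - m₀ < 0) ∧
    (∀ t : ℝ, 0 ≤ t →
      deriv (deriv x₁) t * (ρ₁ * x₁ t - ρ₁ * u₁ * t - m₀)
        + deriv x₁ t * (ρ₁ * deriv x₁ t - 2 * ρ₁ * u₁)
        + ρ₁ * u₁ ^ 2 = 0) := by
  obtain ⟨c, hc⟩ : ∃ c, c = m₀ * (u₁ - u₀) := ⟨_, rfl⟩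
  have hcpos : 0 < c := hc ▸ mul_pos hm₀ (sub_pos.2 h₀₁)
  have hg' : ∀ t, g t = 2 * c * ρ₁ * t + m₀ ^ 2 := fun t => by rw [hg, hc]; ring
  have hx' : x₁ = fun t => u₁ * t + m₀ / ρ₁ - √(2 * c * ρ₁ * t + m₀ ^ 2) / ρ₁ := by
    funext t; rw [hx, hg']
  have hpos : ∀ t, 0 ≤ t → 0 < g t := fun t ht => by rw [hg']; positivity
  have hd : ∀ t, 0 < g t → HasDerivAt x₁ (u₁ - c / √(g t)) t := fun t ht => by
    rw [hg'] at ht ⊢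
    rw [hx']
    exact hasDerivAt_sub_sqrt_affine_div hρ₁.ne' _ _ _ _ ht
  have hcont : Continuous g := by
    rw [funext hg]
    fun_prop
  have hdd : ∀ t, 0 < g t → HasDerivAt (deriv x₁) (c ^ 2 * ρ₁ / √(g t) ^ 3) t := fun t ht => by
    have hev : deriv x₁ =ᶠ[nhds t] fun s => u₁ - c / √(2 * c * ρ₁ * s + m₀ ^ 2) := by
      filter_upwards [hcont.continuousAt.eventually_const_lt ht] with s hs
      rw [(hd s hs).deriv, hg']
    rw [hg'] at ht ⊢
    exact (hasDerivAt_sub_div_sqrt_affine ρ₁ u₁ c (m₀ ^ 2) ht).congr_of_eventuallyEq hev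
  have hsqrt : √(g 0) = m₀ := by
    rw [hg, mul_zero, zero_add, Real.sqrt_sq hm₀.le]
  have hval : ∀ t, ρ₁ * x₁ t - ρ₁ * u₁ * t - m₀ = -√(g t) := fun t => by
    rw [hx]
    field_simp
    ring
  refine ⟨fun t ht => ⟨(hd t (hpos t ht)).differentiableAt, (hdd t (hpos t ht)).differentiableAt⟩,
    ?_, ?_, fun t ht => ⟨hval t, ?_⟩, fun t ht => ?_⟩
  · rw [hx, hsqrt]
    ring
  · rw [(hd 0 (hpos 0 le_rfl)).deriv, hsqrt, hc]
    field_simp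
    ring
  · rw [hval]
    exact neg_lt_zero.2 (Real.sqrt_pos.2 (hpos t ht))
  · rw [hval, (hdd t (hpos t ht)).deriv, (hd t (hpos t ht)).deriv]
    have hs : √(g t) ≠ 0 := (Real.sqrt_pos.2 (hpos t ht)).ne'
    field_simp
    ring
end

section
/- Let ρ₁ > 0, m₀ > 0 and u₀ < u₁ be real constants, and let x₁(t) = u₁t + m₀/ρ₁ − √(g(t))/ρ₁ with g(t) = 2m₀ρ₁(u₁−u₀)t + m₀². Then x₁'(t) = u₁ − m₀(u₁−u₀)/√(g(t)) for all t ≥ 0, the function x₁' is strictly increasing on [0, ∞), u₀ ≤ x₁'(t) < u₁ for every t ≥ 0, and lim_{t→∞} x₁'(t) = u₁. -/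
/-- Case 2: the piston's velocity is `x₁'(t) = u₁ − m₀(u₁−u₀)/√(g t)`, it is
strictly increasing on `[0,∞)`, satisfies `u₀ ≤ x₁'(t) < u₁`, and tends to `u₁`
as `t → ∞`. -/
theorem piston_one_sided_velocity (ρ₁ m₀ u₀ u₁ : ℝ)
    (hρ₁ : 0 < ρ₁) (hm₀ : 0 < m₀) (h₀₁ : u₀ < u₁)
    (g x₁ : ℝ → ℝ)
    (hg : ∀ t : ℝ, g t = 2 * m₀ * ρ₁ * (u₁ - u₀) * t + m₀ ^ 2)
    (hx : ∀ t : ℝ, x₁ t = u₁ * t + m₀ / ρ₁ - Real.sqrt (g t) / ρ₁) :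
    (∀ t : ℝ, 0 ≤ t → deriv x₁ t = u₁ - m₀ * (u₁ - u₀) / Real.sqrt (g t)) ∧
    StrictMonoOn (deriv x₁) (Set.Ici 0) ∧
    (∀ t : ℝ, 0 ≤ t → u₀ ≤ deriv x₁ t ∧ deriv x₁ t < u₁) ∧
    Filter.Tendsto (deriv x₁) Filter.atTop (nhds u₁) := by
  have hd : 0 < u₁ - u₀ := sub_pos.mpr h₀₁
  have hc : 0 < 2 * m₀ * ρ₁ * (u₁ - u₀) := by positivity
  have hpos : ∀ t : ℝ, 0 ≤ t → 0 < g t := fun t ht => by rw [hg]; positivity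
  have hderiv : ∀ t : ℝ, 0 ≤ t →
      deriv x₁ t = u₁ - m₀ * (u₁ - u₀) / Real.sqrt (g t) := by
    intro t ht
    have hgd : HasDerivAt g (2 * m₀ * ρ₁ * (u₁ - u₀)) t := by
      rw [funext hg]
      simpa using ((hasDerivAt_id t).const_mul (2 * m₀ * ρ₁ * (u₁ - u₀))).add_const (m₀ ^ 2)
    have hlin : HasDerivAt (fun t => u₁ * t + m₀ / ρ₁) u₁ t := by
      simpa using ((hasDerivAt_id t).const_mul u₁).add_const (m₀ / ρ₁)
    have hxd := hlin.sub ((hgd.sqrt (hpos t ht).ne').div_const ρ₁)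
    have hs : Real.sqrt (g t) ≠ 0 := (Real.sqrt_pos.mpr (hpos t ht)).ne'
    have hfun : x₁ = (fun t => u₁ * t + m₀ / ρ₁) - fun t => Real.sqrt (g t) / ρ₁ := funext hx
    rw [hfun, hxd.deriv]
    field_simp
  refine ⟨hderiv, ?_, ?_, ?_⟩
  · intro a ha b hb hab
    rw [hderiv a ha, hderiv b hb]
    have hgab : g a < g b := by
      rw [hg, hg]
      gcongr
    have hsa := Real.sqrt_pos.mpr (hpos a ha)
    have hsab := Real.sqrt_lt_sqrt (hpos a ha).le hgab
    gcongr
  · intro t ht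
    rw [hderiv t ht]
    have hs := Real.sqrt_pos.mpr (hpos t ht)
    have hms : m₀ ≤ Real.sqrt (g t) := by
      apply Real.le_sqrt_of_sq_le
      rw [hg]
      exact le_add_of_nonneg_left (by positivity)
    refine ⟨?_, sub_lt_self _ (by positivity)⟩
    have : m₀ * (u₁ - u₀) / Real.sqrt (g t) ≤ u₁ - u₀ := by
      rw [div_le_iff₀ hs, mul_comm]
      gcongr
    linarith
  · have hgt : Filter.Tendsto g Filter.atTop Filter.atTop := by
      rw [funext hg]
      exact Filter.tendsto_atTop_add_const_right _ _ (Filter.tendsto_id.const_mul_atTop hc)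
    have hlim : Filter.Tendsto (fun t => u₁ - m₀ * (u₁ - u₀) / Real.sqrt (g t))
        Filter.atTop (nhds u₁) := by
      simpa using ((Real.tendsto_sqrt_atTop.comp hgt).const_div_atTop
        (m₀ * (u₁ - u₀))).const_sub u₁
    refine hlim.congr' ?_
    filter_upwards [Filter.eventually_ge_atTop 0] with t ht
    exact (hderiv t ht).symm
end

section
/- Let ρ₁ > 0, m₀ > 0 and real constants u₀ < u₁ ≤ u₂ be given, and let x₁(t) = u₁t + m₀/ρ₁ − √(g(t))/ρ₁ with g(t) = 2m₀ρ₁(u₁−u₀)t + m₀². Then x₁(t) < u₂t for every t > 0; that is, the piston never catches up with the gas moving with speed u₂ on its right, and a vacuum region persists on its right side for all positive times. -/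
/-- Case 2 (`u₀ < u₁ ≤ u₂`): the piston never catches up with the gas moving
with speed `u₂` on its right: `x₁(t) < u₂·t` for all `t > 0`, so a vacuum
persists on the right side of the piston. -/
theorem piston_never_catches_up (ρ₁ m₀ u₀ u₁ u₂ : ℝ)
    (hρ₁ : 0 < ρ₁) (hm₀ : 0 < m₀) (h₀₁ : u₀ < u₁) (h₁₂ : u₁ ≤ u₂)
    (g x₁ : ℝ → ℝ)
    (hg : ∀ t : ℝ, g t = 2 * m₀ * ρ₁ * (u₁ - u₀) * t + m₀ ^ 2)
    (hx : ∀ t : ℝ, x₁ t = u₁ * t + m₀ / ρ₁ - Real.sqrt (g t) / ρ₁) :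
    ∀ t : ℝ, 0 < t → x₁ t < u₂ * t := by
  intro t ht
  have h_sqrt : m₀ < Real.sqrt (g t) := by
    apply Real.lt_sqrt_of_sq_lt
    rw [hg]
    have : 0 < 2 * m₀ * ρ₁ * (u₁ - u₀) * t := by
      have := sub_pos.mpr h₀₁
      positivity
    linarith
  have h_div : m₀ / ρ₁ < Real.sqrt (g t) / ρ₁ := div_lt_div_of_pos_right h_sqrt hρ₁
  have h_mul : u₁ * t ≤ u₂ * t := mul_le_mul_of_nonneg_right h₁₂ ht.le
  rw [hx]
  linarith
end

section
/- Let ρ₁ > 0, m₀ > 0 and real constants u₀ < u₂ < u₁ be given, and let x₁(t) = u₁t + m₀/ρ₁ − √(g(t))/ρ₁ with g(t) = 2m₀ρ₁(u₁−u₀)t + m₀². Then t₁ := 2m₀(u₂−u₀)/(ρ₁(u₁−u₂)²) is the unique positive time at which x₁(t) = u₂t; i.e., x₁(t₁) = u₂t₁ and for every t > 0 with t ≠ t₁ one has x₁(t) ≠ u₂t. -/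
/-- Case 3 (`u₀ < u₂ < u₁`): the time `t₁ = 2m₀(u₂−u₀)/(ρ₁(u₁−u₂)²)` is the
unique positive time at which the piston catches up with the right-moving gas,
i.e. `x₁(t₁) = u₂·t₁` and `x₁(t) ≠ u₂·t` for every other `t > 0`. -/
theorem piston_catch_up_time (ρ₁ m₀ u₀ u₁ u₂ : ℝ)
    (hρ₁ : 0 < ρ₁) (hm₀ : 0 < m₀) (h₀₂ : u₀ < u₂) (h₂₁ : u₂ < u₁)
    (g x₁ : ℝ → ℝ)
    (hg : ∀ t : ℝ, g t = 2 * m₀ * ρ₁ * (u₁ - u₀) * t + m₀ ^ 2)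
    (hx : ∀ t : ℝ, x₁ t = u₁ * t + m₀ / ρ₁ - Real.sqrt (g t) / ρ₁)
    (t₁ : ℝ) (ht₁ : t₁ = 2 * m₀ * (u₂ - u₀) / (ρ₁ * (u₁ - u₂) ^ 2)) :
    0 < t₁ ∧ x₁ t₁ = u₂ * t₁ ∧
    ∀ t : ℝ, 0 < t → t ≠ t₁ → x₁ t ≠ u₂ * t := by
  have hd : 0 < u₁ - u₂ := sub_pos.mpr h₂₁
  have he : 0 < u₂ - u₀ := sub_pos.mpr h₀₂
  have key : ∀ t : ℝ, 0 < t → (x₁ t = u₂ * t ↔ t = t₁) := by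
    intro t ht
    have hpos : 0 ≤ ρ₁ * (u₁ - u₂) * t + m₀ := by positivity
    have hg_nonneg : 0 ≤ g t := by
      have : 0 < u₁ - u₀ := by linarith
      rw [hg]
      positivity
    have hsqrt : x₁ t = u₂ * t ↔ √(g t) = ρ₁ * (u₁ - u₂) * t + m₀ := by
      rw [hx]
      field_simp
      constructor <;> intro h <;> linarith
    rw [hsqrt, Real.sqrt_eq_iff_eq_sq hg_nonneg hpos, hg, ht₁, eq_div_iff (by positivity)]
    constructor
    · intro h
      have hρt : ρ₁ * t ≠ 0 := by positivity
      apply mul_left_cancel₀ hρt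
      linear_combination -h
    · intro h
      linear_combination -(ρ₁ * t) * h
  have ht₁_pos : 0 < t₁ := by
    rw [ht₁]
    positivity
  exact ⟨ht₁_pos, (key t₁ ht₁_pos).mpr rfl, fun t ht hne h => hne ((key t ht).mp h)⟩
end

section
/- Let ρ₁ > 0, m₀ > 0 and real constants u₀ < u₂ < u₁ be given, let x₁(t) = u₁t + m₀/ρ₁ − √(g(t))/ρ₁ with g(t) = 2m₀ρ₁(u₁−u₀)t + m₀², and let t₁ = 2m₀(u₂−u₀)/(ρ₁(u₁−u₂)²). Then x₁'(t₁) = (2u₁u₂ − u₀u₁ − u₀u₂)/(u₁ + u₂ − 2u₀), and this value lies strictly between u₂ and u₁. -/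
/-- Case 3 (`u₀ < u₂ < u₁`): at the catch-up time `t₁` the piston's velocity is
`x₁'(t₁) = (2u₁u₂ − u₀u₁ − u₀u₂)/(u₁ + u₂ − 2u₀)`, and this value lies strictly
between `u₂` and `u₁`. -/
theorem piston_velocity_at_catch_up (ρ₁ m₀ u₀ u₁ u₂ : ℝ)
    (hρ₁ : 0 < ρ₁) (hm₀ : 0 < m₀) (h₀₂ : u₀ < u₂) (h₂₁ : u₂ < u₁)
    (g x₁ : ℝ → ℝ)
    (hg : ∀ t : ℝ, g t = 2 * m₀ * ρ₁ * (u₁ - u₀) * t + m₀ ^ 2)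
    (hx : ∀ t : ℝ, x₁ t = u₁ * t + m₀ / ρ₁ - Real.sqrt (g t) / ρ₁)
    (t₁ : ℝ) (ht₁ : t₁ = 2 * m₀ * (u₂ - u₀) / (ρ₁ * (u₁ - u₂) ^ 2)) :
    deriv x₁ t₁ = (2 * u₁ * u₂ - u₀ * u₁ - u₀ * u₂) / (u₁ + u₂ - 2 * u₀) ∧
    u₂ < deriv x₁ t₁ ∧ deriv x₁ t₁ < u₁ := by
  have ha : 0 < u₁ - u₂ := sub_pos.2 h₂₁
  have hs : 0 < u₁ + u₂ - 2 * u₀ := by linarith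
  have hgt : g t₁ = (m₀ * (u₁ + u₂ - 2 * u₀) / (u₁ - u₂)) ^ 2 := by
    rw [hg, ht₁]
    field_simp
    ring
  have hpos : 0 < m₀ * (u₁ + u₂ - 2 * u₀) / (u₁ - u₂) := by positivity
  have hsqrt : Real.sqrt (g t₁) = m₀ * (u₁ + u₂ - 2 * u₀) / (u₁ - u₂) := by
    rw [hgt, Real.sqrt_sq hpos.le]
  have hne : g t₁ ≠ 0 := by
    rw [hgt]
    positivity
  have hg' : HasDerivAt g (2 * m₀ * ρ₁ * (u₁ - u₀)) t₁ := by
    rw [funext hg]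
    simpa using ((hasDerivAt_id t₁).const_mul (2 * m₀ * ρ₁ * (u₁ - u₀))).add_const (m₀ ^ 2)
  have hx' : HasDerivAt x₁
      (u₁ - 2 * m₀ * ρ₁ * (u₁ - u₀) / (2 * Real.sqrt (g t₁)) / ρ₁) t₁ := by
    rw [funext hx]
    have hl : HasDerivAt (fun t => u₁ * t + m₀ / ρ₁) u₁ t₁ := by
      simpa using ((hasDerivAt_id t₁).const_mul u₁).add_const (m₀ / ρ₁)
    exact hl.sub ((hg'.sqrt hne).div_const ρ₁)
  have hd : deriv x₁ t₁ = (2 * u₁ * u₂ - u₀ * u₁ - u₀ * u₂) / (u₁ + u₂ - 2 * u₀) := by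
    rw [hx'.deriv, hsqrt]
    field_simp
    ring
  refine ⟨hd, ?_, ?_⟩
  · rw [hd, lt_div_iff₀ hs]
    linarith [mul_pos ha (sub_pos.2 h₀₂)]
  · rw [hd, div_lt_iff₀ hs]
    linarith [mul_pos ha (sub_pos.2 (h₀₂.trans h₂₁))]
end

section
/- Let ρ₁ > 0, ρ₂ > 0, m₀ > 0, u₂ < u₀ < u₁ and ρ₁ ≠ ρ₂ be real constants, and let x₁(t) = [(ρ₁u₁−ρ₂u₂)t + m₀ − √(f(t))]/(ρ₁−ρ₂) with f(t) = ρ₁ρ₂(u₁−u₂)²t² + 2m₀[ρ₁(u₁−u₀) − ρ₂(u₂−u₀)]t + m₀². Define the delta shock weight α(t) = (ρ₂−ρ₁)x₁(t) − (ρ₂u₂−ρ₁u₁)t + m₀. Then α(t) = √(f(t)) for all t ≥ 0; in particular α(t) ≥ m₀ > 0 for all t ≥ 0, α(0) = m₀, and α is strictly increasing on [0, ∞). -/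
/-- Case 1 (`ρ₁ ≠ ρ₂`): the delta shock weight
`α(t) = (ρ₂−ρ₁)x₁(t) − (ρ₂u₂−ρ₁u₁)t + m₀` equals `√(f t)` for all `t ≥ 0`;
in particular `α(t) ≥ m₀ > 0`, `α(0) = m₀`, and `α` is strictly increasing on
`[0,∞)`. -/
theorem delta_shock_weight (ρ₁ ρ₂ m₀ u₀ u₁ u₂ : ℝ)
    (hρ₁ : 0 < ρ₁) (hρ₂ : 0 < ρ₂) (hm₀ : 0 < m₀)
    (h₂₀ : u₂ < u₀) (h₀₁ : u₀ < u₁) (hne : ρ₁ ≠ ρ₂)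
    (f x₁ α : ℝ → ℝ)
    (hf : ∀ t : ℝ, f t =
      ρ₁ * ρ₂ * (u₁ - u₂) ^ 2 * t ^ 2
        + 2 * m₀ * (ρ₁ * (u₁ - u₀) - ρ₂ * (u₂ - u₀)) * t + m₀ ^ 2)
    (hx : ∀ t : ℝ, x₁ t =
      ((ρ₁ * u₁ - ρ₂ * u₂) * t + m₀ - Real.sqrt (f t)) / (ρ₁ - ρ₂))
    (hα : ∀ t : ℝ, α t = (ρ₂ - ρ₁) * x₁ t - (ρ₂ * u₂ - ρ₁ * u₁) * t + m₀) :
    (∀ t : ℝ, 0 ≤ t → α t = Real.sqrt (f t)) ∧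
    (∀ t : ℝ, 0 ≤ t → m₀ ≤ α t) ∧ 0 < m₀ ∧
    α 0 = m₀ ∧
    StrictMonoOn α (Set.Ici 0) := by
  have hαf : ∀ t, α t = Real.sqrt (f t) := by
    intro t
    have hd : ρ₁ - ρ₂ ≠ 0 := sub_ne_zero.mpr hne
    rw [hα, hx]
    field_simp
    ring
  have ha : 0 < ρ₁ * ρ₂ * (u₁ - u₂) ^ 2 := by
    have : 0 < u₁ - u₂ := by linarith
    positivity
  have hb : 0 < 2 * m₀ * (ρ₁ * (u₁ - u₀) - ρ₂ * (u₂ - u₀)) := by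
    have h₁ := mul_pos hρ₁ (sub_pos.mpr h₀₁)
    have h₂ := mul_pos hρ₂ (sub_pos.mpr h₂₀)
    exact mul_pos (by linarith) (by linarith)
  have hf₀ : f 0 = m₀ ^ 2 := by simp [hf]
  have hα₀ : α 0 = m₀ := by rw [hαf, hf₀, Real.sqrt_sq hm₀.le]
  have hmono_f : StrictMonoOn f (Set.Ici 0) := by
    intro s hs t _ hst
    have hs : 0 ≤ s := hs
    rw [hf, hf]
    gcongr
  have hmono : StrictMonoOn α (Set.Ici 0) := by
    intro s hs t ht hst
    have hfs : 0 ≤ f s := by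
      have := hmono_f.monotoneOn Set.self_mem_Ici hs hs
      rw [hf₀] at this
      exact (sq_nonneg m₀).trans this
    rw [hαf, hαf]
    exact Real.sqrt_lt_sqrt hfs (hmono_f hs ht hst)
  refine ⟨fun t _ => hαf t, fun t ht => ?_, hm₀, hα₀, hmono⟩
  rw [← hα₀]
  exact hmono.monotoneOn Set.self_mem_Ici ht ht
end

section
/- Let ρ₁ > 0, m₀ > 0 and u₀ < u₁ be real constants, and let x₁(t) = u₁t + m₀/ρ₁ − √(g(t))/ρ₁ with g(t) = 2m₀ρ₁(u₁−u₀)t + m₀². Define the force exerted on the left side of the piston by w_p¹(t) = x₁''(t)·(ρ₁x₁(t) − ρ₁u₁t) + x₁'(t)·(ρ₁x₁'(t) − 2ρ₁u₁) + ρ₁u₁². Then w_p¹(t) = m₀·x₁''(t) = m₀³ρ₁(u₁−u₀)²/g(t)^{3/2} for every t ≥ 0; in particular w_p¹(t) ≥ 0 for all t ≥ 0. -/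
theorem hasDerivAt_sqrt_affine {a b t : ℝ} (h : 0 < 2 * a * t + b) :
    HasDerivAt (fun s => √(2 * a * s + b)) (a / √(2 * a * t + b)) t := by
  have hlin : HasDerivAt (fun s => 2 * a * s + b) (2 * a) t := by
    simpa using ((hasDerivAt_id t).const_mul (2 * a)).add_const b
  convert hlin.sqrt h.ne' using 1
  field_simp

theorem hasDerivAt_div_sqrt_affine {a b t : ℝ} (h : 0 < 2 * a * t + b) :
    HasDerivAt (fun s => a / √(2 * a * s + b)) (-(a ^ 2 / √(2 * a * t + b) ^ 3)) t := by
  have hs : √(2 * a * t + b) ≠ 0 := (Real.sqrt_pos.2 h).ne'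
  refine ((hasDerivAt_const t a).div (hasDerivAt_sqrt_affine h) hs).congr_deriv ?_
  field_simp
  ring

/-- Case 2: the inertial force on the left side of the piston,
`w_p¹(t) = x₁''(t)(ρ₁x₁(t) − ρ₁u₁t) + x₁'(t)(ρ₁x₁'(t) − 2ρ₁u₁) + ρ₁u₁²`,
equals `m₀·x₁''(t) = m₀³ρ₁(u₁−u₀)²/g(t)^{3/2}` and is nonnegative for `t ≥ 0`. -/
theorem piston_force_nonneg (ρ₁ m₀ u₀ u₁ : ℝ)
    (hρ₁ : 0 < ρ₁) (hm₀ : 0 < m₀) (h₀₁ : u₀ < u₁)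
    (g x₁ wp : ℝ → ℝ)
    (hg : ∀ t : ℝ, g t = 2 * m₀ * ρ₁ * (u₁ - u₀) * t + m₀ ^ 2)
    (hx : ∀ t : ℝ, x₁ t = u₁ * t + m₀ / ρ₁ - Real.sqrt (g t) / ρ₁)
    (hwp : ∀ t : ℝ, wp t =
      deriv (deriv x₁) t * (ρ₁ * x₁ t - ρ₁ * u₁ * t)
        + deriv x₁ t * (ρ₁ * deriv x₁ t - 2 * ρ₁ * u₁) + ρ₁ * u₁ ^ 2) :
    ∀ t : ℝ, 0 ≤ t →
      wp t = m₀ * deriv (deriv x₁) t ∧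
      wp t = m₀ ^ 3 * ρ₁ * (u₁ - u₀) ^ 2 / g t ^ ((3 : ℝ) / 2) ∧
      0 ≤ wp t := by
  have ha : 0 < m₀ * ρ₁ * (u₁ - u₀) := mul_pos (mul_pos hm₀ hρ₁) (sub_pos.2 h₀₁)
  set a := m₀ * ρ₁ * (u₁ - u₀) with ha_def
  have hg' : ∀ t, g t = 2 * a * t + m₀ ^ 2 := fun t => by rw [hg, ha_def]; ring
  have hx_deriv : ∀ t, 0 < 2 * a * t + m₀ ^ 2 →
      deriv x₁ t = u₁ - a / √(2 * a * t + m₀ ^ 2) / ρ₁ := by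
    intro t ht
    have hx_eq : x₁ = fun s => u₁ * s + m₀ / ρ₁ - √(2 * a * s + m₀ ^ 2) / ρ₁ := by
      funext s
      rw [hx, hg']
    have hlin : HasDerivAt (fun s => u₁ * s + m₀ / ρ₁) u₁ t := by
      simpa using ((hasDerivAt_id t).const_mul u₁).add_const (m₀ / ρ₁)
    rw [hx_eq]
    exact (hlin.sub ((hasDerivAt_sqrt_affine ht).div_const ρ₁)).deriv
  intro t ht
  have hpos : 0 < 2 * a * t + m₀ ^ 2 := by positivity
  have hx_deriv2 : deriv (deriv x₁) t = a ^ 2 / √(2 * a * t + m₀ ^ 2) ^ 3 / ρ₁ := by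
    have hnear : ∀ᶠ s in nhds t, 0 < 2 * a * s + m₀ ^ 2 :=
      (show Continuous fun s : ℝ => 2 * a * s + m₀ ^ 2 by fun_prop).continuousAt.eventually
        (lt_mem_nhds hpos)
    rw [Filter.EventuallyEq.deriv_eq (hnear.mono hx_deriv),
      (((hasDerivAt_div_sqrt_affine hpos).div_const ρ₁).const_sub u₁).deriv]
    ring
  have hforce : wp t = m₀ * deriv (deriv x₁) t := by
    rw [hwp, hx_deriv2, hx_deriv t hpos, hx, hg']
    have hs : 0 < √(2 * a * t + m₀ ^ 2) := Real.sqrt_pos.2 hpos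
    field_simp
    ring
  have hrpow : g t ^ ((3 : ℝ) / 2) = √(2 * a * t + m₀ ^ 2) ^ 3 := by
    rw [hg', Real.sqrt_eq_rpow, ← Real.rpow_mul_natCast hpos.le]
    norm_num
  refine ⟨hforce, ?_, ?_⟩
  · have hs : 0 < √(2 * a * t + m₀ ^ 2) := Real.sqrt_pos.2 hpos
    rw [hforce, hx_deriv2, hrpow]
    generalize √(2 * a * t + m₀ ^ 2) = r at hs
    rw [ha_def]
    field_simp
  · rw [hforce, hx_deriv2]
    positivity
end

section
/- Let ρ₁, ρ₂, u₁, u₂, u₀ be real constants and m₀ ≠ 0. Suppose x : [0, ∞) → ℝ is twice differentiable, x(0) = 0, and x satisfies the momentum conservation relation x'(t)·[ρ₁u₁t − ρ₁x(t) + m₀ − ρ₂u₂t + ρ₂x(t)] = ρ₁u₁²t − ρ₁u₁x(t) − ρ₂u₂²t + ρ₂u₂x(t) + m₀u₀ for all t ≥ 0. Then x'(0) = u₀ and x solves the free piston ODE x''(t)·D(t) + [(ρ₁−ρ₂)x'(t) − 2(ρ₁u₁−ρ₂u₂)]·x'(t) + (ρ₁u₁² − ρ₂u₂²) = 0 for all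 t ≥ 0, where D(t) = (ρ₁−ρ₂)x(t) − (ρ₁u₁−ρ₂u₂)t − m₀. -/
/-- Sticky particle derivation: if a twice differentiable trajectory `x` with
`x(0) = 0` satisfies the momentum conservation relation for all `t ≥ 0` and the
piston mass `m₀` is nonzero, then `x'(0) = u₀` and `x` solves the free piston
ODE for all `t ≥ 0`. -/
theorem momentum_relation_implies_ODE (ρ₁ ρ₂ m₀ u₀ u₁ u₂ : ℝ)
    (hm₀ : m₀ ≠ 0)
    (x : ℝ → ℝ)
    (hdiff : ∀ t : ℝ, 0 ≤ t → DifferentiableAt ℝ x t ∧ DifferentiableAt ℝ (deriv x) t)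
    (hx0 : x 0 = 0)
    (hmom : ∀ t : ℝ, 0 ≤ t →
      deriv x t * (ρ₁ * u₁ * t - ρ₁ * x t + m₀ - ρ₂ * u₂ * t + ρ₂ * x t) =
      ρ₁ * u₁ ^ 2 * t - ρ₁ * u₁ * x t - ρ₂ * u₂ ^ 2 * t + ρ₂ * u₂ * x t
        + m₀ * u₀) :
    deriv x 0 = u₀ ∧
    ∀ t : ℝ, 0 ≤ t →
      deriv (deriv x) t *
          ((ρ₁ - ρ₂) * x t - (ρ₁ * u₁ - ρ₂ * u₂) * t - m₀)
        + ((ρ₁ - ρ₂) * deriv x t - 2 * (ρ₁ * u₁ - ρ₂ * u₂)) * deriv x t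
        + (ρ₁ * u₁ ^ 2 - ρ₂ * u₂ ^ 2) = 0 := by
  constructor
  · have h := hmom 0 le_rfl
    simp only [hx0, mul_zero, sub_zero, zero_add, add_zero] at h
    exact mul_right_cancel₀ hm₀ (h.trans (mul_comm _ _))
  · intro t ht
    have hx := (hdiff t ht).1.hasDerivAt
    have hx' := (hdiff t ht).2.hasDerivAt
    have hid := hasDerivAt_id' t
    have hL := hx'.mul (((((hid.const_mul (ρ₁ * u₁)).sub (hx.const_mul ρ₁)).add_const m₀).sub
      (hid.const_mul (ρ₂ * u₂))).add (hx.const_mul ρ₂))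
    have hR := ((((hid.const_mul (ρ₁ * u₁ ^ 2)).sub (hx.const_mul (ρ₁ * u₁))).sub
      (hid.const_mul (ρ₂ * u₂ ^ 2))).add (hx.const_mul (ρ₂ * u₂))).add_const (m₀ * u₀)
    have hLR := hR.hasDerivWithinAt.congr (s := Set.Ici t)
      (fun s hs => hmom s (ht.trans hs)) (hmom t ht)
    have h := (uniqueDiffWithinAt_Ici t).eq_deriv _ hL.hasDerivWithinAt hLR
    simp only [Pi.add_apply, Pi.sub_apply] at h
    linear_combination -h
end

section
/- Let ρ₁ > 0, ρ₂ > 0 and u₁, u₂ be real constants. If ρ₁ ≠ ρ₂, then the set of real solutions u of the quadratic equation (ρ₂−ρ₁)u² − 2(ρ₂u₂−ρ₁u₁)u + (ρ₂u₂² − ρ₁u₁²) = 0 is exactly { (√ρ₂·u₂ + √ρ₁·u₁)/(√ρ₂ + √ρ₁), (√ρ₂·u₂ − √ρ₁·u₁)/(√ρ₂ − √ρ₁) }. If ρ₁ = ρ₂ and u₁ ≠ u₂, then the unique solution of the (then linear) equation is u = (u₁+u₂)/2. -/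
/-- Limiting case `m₀ = 0`: the admissible initial velocities of a massless
piston. If `ρ₁ ≠ ρ₂`, the solutions of
`(ρ₂−ρ₁)u² − 2(ρ₂u₂−ρ₁u₁)u + (ρ₂u₂² − ρ₁u₁²) = 0` are exactly
`(√ρ₂·u₂ + √ρ₁·u₁)/(√ρ₂ + √ρ₁)` and `(√ρ₂·u₂ − √ρ₁·u₁)/(√ρ₂ − √ρ₁)`;
if `ρ₁ = ρ₂` and `u₁ ≠ u₂`, the unique solution is `(u₁+u₂)/2`. -/
theorem massless_piston_velocity (ρ₁ ρ₂ u₁ u₂ : ℝ)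
    (hρ₁ : 0 < ρ₁) (hρ₂ : 0 < ρ₂) :
    (ρ₁ ≠ ρ₂ →
      {u : ℝ | (ρ₂ - ρ₁) * u ^ 2 - 2 * (ρ₂ * u₂ - ρ₁ * u₁) * u
          + (ρ₂ * u₂ ^ 2 - ρ₁ * u₁ ^ 2) = 0} =
        {(Real.sqrt ρ₂ * u₂ + Real.sqrt ρ₁ * u₁) / (Real.sqrt ρ₂ + Real.sqrt ρ₁),
         (Real.sqrt ρ₂ * u₂ - Real.sqrt ρ₁ * u₁) / (Real.sqrt ρ₂ - Real.sqrt ρ₁)}) ∧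
    (ρ₁ = ρ₂ → u₁ ≠ u₂ →
      ∀ u : ℝ,
        (ρ₂ - ρ₁) * u ^ 2 - 2 * (ρ₂ * u₂ - ρ₁ * u₁) * u
          + (ρ₂ * u₂ ^ 2 - ρ₁ * u₁ ^ 2) = 0 ↔ u = (u₁ + u₂) / 2) := by
  constructor
  · intro hne
    have ha : 0 < √ρ₁ := Real.sqrt_pos.2 hρ₁
    have hb : 0 < √ρ₂ := Real.sqrt_pos.2 hρ₂
    have hsum : √ρ₂ + √ρ₁ ≠ 0 := by positivity
    have hdiff : √ρ₂ - √ρ₁ ≠ 0 := fun h =>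
      hne ((Real.sqrt_inj hρ₁.le hρ₂.le).1 (sub_eq_zero.1 h).symm)
    ext u
    have hfactor : (ρ₂ - ρ₁) * u ^ 2 - 2 * (ρ₂ * u₂ - ρ₁ * u₁) * u
          + (ρ₂ * u₂ ^ 2 - ρ₁ * u₁ ^ 2) =
        (u * (√ρ₂ + √ρ₁) - (√ρ₂ * u₂ + √ρ₁ * u₁)) *
          (u * (√ρ₂ - √ρ₁) - (√ρ₂ * u₂ - √ρ₁ * u₁)) := by
      linear_combination (u - u₁) ^ 2 * Real.sq_sqrt hρ₁.le
        - (u - u₂) ^ 2 * Real.sq_sqrt hρ₂.le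
    rw [Set.mem_ofPred_eq, Set.mem_insert_iff, Set.mem_singleton_iff, hfactor, mul_eq_zero,
      sub_eq_zero, sub_eq_zero, eq_div_iff hsum, eq_div_iff hdiff]
  · rintro rfl hu u
    have hfactor : (ρ₁ - ρ₁) * u ^ 2 - 2 * (ρ₁ * u₂ - ρ₁ * u₁) * u
          + (ρ₁ * u₂ ^ 2 - ρ₁ * u₁ ^ 2) =
        2 * ρ₁ * (u₁ - u₂) * (u - (u₁ + u₂) / 2) := by ring
    have hcoeff : 2 * ρ₁ * (u₁ - u₂) ≠ 0 := mul_ne_zero (by positivity) (sub_ne_zero.2 hu)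
    rw [hfactor, mul_eq_zero_iff_left hcoeff, sub_eq_zero]
end
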